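/- Let q be an odd prime power and A,B,C,D,E ∈ F_q, not all zero. The polynomial f(X) = EX² + AX^{q+1} + BX^{q²+1} + CX^{2q} + DX^{2q²} is planar on F_{q³} if and only if for every nonzero ε ∈ F_{q³}: (-2A²D + 2ABE - 2B²C)(ε³ + ε^{3q} + ε^{3q²}) + (2A²C - 2ABD - 4ACD + 4AE² + 2B²E - 4BCE + 4BD²)(ε^{2+q} + ε^{1+2q²} + ε^{2q+q²}) + (2A²E - 2ABC + 4AC² - 4ADE + 2B²D - 4BCD + 4BE²)(ε^{2+q²} + ε^{1+2q} + ε^{q+2q²}) + (2A³ + 2B³ + 8C³ - 24CDE + 8D³ + 8E³)ε^{1+q+q²} ≠ 0. -/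

import Mathlib

theorem aux_poly_zero (q : ℕ) (hq : 1 < q) (L : Type) [Field L] [Fintype L]
    (hL : Fintype.card L = q ^ 3) (u v w : L)
    (h : ∀ y : L, u * y + v * y ^ q + w * y ^ q ^ 2 = 0) : u = 0 ∧ v = 0 ∧ w = 0 := by
  have hqq : q < q ^ 2 := by nlinarith
  have hqqq : q ^ 2 < q ^ 3 := Nat.pow_lt_pow_right hq (by norm_num)
  let P : Polynomial L := Polynomial.C u * Polynomial.X + Polynomial.C v * Polynomial.X ^ q
    + Polynomial.C w * Polynomial.X ^ q ^ 2
  have hdeg : P.natDegree ≤ q ^ 2 := by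
    refine Polynomial.natDegree_add_le_of_degree_le (Polynomial.natDegree_add_le_of_degree_le ?_ ?_) ?_
    · exact (by simpa using Polynomial.natDegree_C_mul_X_pow_le u 1 : _ ≤ 1).trans (by omega)
    · exact (Polynomial.natDegree_C_mul_X_pow_le v q).trans (by omega)
    · exact (Polynomial.natDegree_C_mul_X_pow_le w _)
  have hP : P = 0 := by
    refine Polynomial.eq_zero_of_natDegree_lt_card_of_eval_eq_zero P (f := (id : L → L))
      Function.injective_id ?_ ?_
    · intro y
      simpa [P] using h y
    · rw [hL]; omega
  have h1 := congrArg (fun p => p.coeff 1) hP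
  have h2 := congrArg (fun p => p.coeff q) hP
  have h3 := congrArg (fun p => p.coeff (q ^ 2)) hP
  have e1 : ¬ 1 = q := by omega
  have e2 : ¬ 1 = q ^ 2 := by omega
  have e3 : ¬ q = q ^ 2 := by omega
  simp only [P, Polynomial.coeff_add, Polynomial.coeff_C_mul, Polynomial.coeff_X_pow,
    Polynomial.coeff_X, Polynomial.coeff_zero] at h1 h2 h3
  simp only [e1, e2, e3, Ne.symm e3, if_true, if_false] at h1 h2 h3
  simp at h1 h2 h3
  exact ⟨h1, h2, h3⟩

theorem aux_dickson (q : ℕ) (hq : 1 < q) (L : Type) [Field L] [Fintype L]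
    (hL : Fintype.card L = q ^ 3) (σ : L →+* L) (hσ : ∀ x, σ x = x ^ q)
    (hσ3 : ∀ x, σ (σ (σ x)) = x) (a b c : L) :
    Function.Bijective (fun x => a * x + b * σ x + c * σ (σ x)) ↔
      Matrix.det !![a, b, c; σ c, σ a, σ b; σ (σ b), σ (σ c), σ (σ a)] ≠ 0 := by
  constructor
  · intro hb hdet
    obtain ⟨v, hv, hvM⟩ := Matrix.exists_vecMul_eq_zero_iff.mpr hdet
    apply hv
    have k0 := congrFun hvM 0
    have k1 := congrFun hvM 1
    have k2 := congrFun hvM 2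
    simp [Matrix.vecMul, dotProduct, Fin.sum_univ_three] at k0 k1 k2
    have := aux_poly_zero q hq L hL (v 0) (v 1) (v 2) (by
      intro y
      obtain ⟨x, rfl⟩ := hb.2 y
      have e2 : ∀ y : L, y ^ q ^ 2 = σ (σ y) := by
        intro y; rw [hσ, hσ, ← pow_mul, sq]
      rw [e2, ← hσ]
      simp only [map_add, map_mul, hσ3]
      linear_combination x * k0 + σ x * k1 + σ (σ x) * k2)
    ext i
    fin_cases i
    · exact this.1
    · exact this.2.1
    · exact this.2.2
  · intro hdet
    apply Finite.injective_iff_bijective.mp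
    have key : ∀ x, a * x + b * σ x + c * σ (σ x) = 0 → x = 0 := by
      intro x hx
      have h1 := congrArg σ hx
      have h2 := congrArg σ h1
      simp only [map_add, map_mul, hσ3, map_zero] at h1 h2
      rw [Matrix.det_fin_three] at hdet
      simp at hdet
      by_contra hx0
      apply hdet
      apply mul_right_cancel₀ hx0
      linear_combination (σ a * σ (σ a) - σ b * σ (σ c)) * hx
        + (c * σ (σ c) - b * σ (σ a)) * h1 + (b * σ b - c * σ a) * h2
    intro x y hxy
    apply sub_eq_zero.mp
    apply key
    simp only [map_sub]
    simp only at hxy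
    linear_combination hxy

theorem stmt5 (q : ℕ) (hodd : Odd q) (hpp : ∃ p n : ℕ, Nat.Prime p ∧ 0 < n ∧ q = p ^ n)
    (K L : Type) [Field K] [Field L] [Fintype K] [Fintype L] [Algebra K L]
    (hK : Fintype.card K = q) (hL : Fintype.card L = q ^ 3)
    (A B C D E : K) (hABCDE : ¬(A = 0 ∧ B = 0 ∧ C = 0 ∧ D = 0 ∧ E = 0)) (f : L → L)
    (hf : ∀ x : L, f x = algebraMap K L E * x ^ 2 + algebraMap K L A * (x ^ q * x)
        + algebraMap K L B * (x ^ q ^ 2 * x) + algebraMap K L C * x ^ (2 * q)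
        + algebraMap K L D * x ^ (2 * q ^ 2)) :
    (∀ ε : L, ε ≠ 0 → Function.Bijective (fun x : L => f (x + ε) - f x)) ↔
      ∀ ε : L, ε ≠ 0 →
        algebraMap K L (-2 * A ^ 2 * D + 2 * A * B * E - 2 * B ^ 2 * C)
            * (ε ^ 3 + ε ^ (3 * q) + ε ^ (3 * q ^ 2))
        + algebraMap K L (2 * A ^ 2 * C - 2 * A * B * D - 4 * A * C * D + 4 * A * E ^ 2
              + 2 * B ^ 2 * E - 4 * B * C * E + 4 * B * D ^ 2)
            * (ε ^ 2 * ε ^ q + ε * ε ^ (2 * q ^ 2) + ε ^ (2 * q) * ε ^ q ^ 2)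
        + algebraMap K L (2 * A ^ 2 * E - 2 * A * B * C + 4 * A * C ^ 2 - 4 * A * D * E
              + 2 * B ^ 2 * D - 4 * B * C * D + 4 * B * E ^ 2)
            * (ε ^ 2 * ε ^ q ^ 2 + ε * ε ^ (2 * q) + ε ^ q * ε ^ (2 * q ^ 2))
        + algebraMap K L (2 * A ^ 3 + 2 * B ^ 3 + 8 * C ^ 3 - 24 * C * D * E
              + 8 * D ^ 3 + 8 * E ^ 3)
            * (ε * ε ^ q * ε ^ q ^ 2) ≠ 0 := by
  have hq : 1 < q := by
    rw [← hK]; exact Fintype.one_lt_card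
  let σ : L →+* L := (FiniteField.frobeniusAlgHom K L : L →ₐ[K] L).toRingHom
  have hσ : ∀ x, σ x = x ^ q := by
    intro x
    simp [σ, hK]
  have hσK : ∀ k : K, σ (algebraMap K L k) = algebraMap K L k := by
    intro k
    exact (FiniteField.frobeniusAlgHom K L).commutes k
  clear_value σ
  have e2 : ∀ y : L, y ^ q ^ 2 = σ (σ y) := by
    intro y; rw [hσ, hσ, ← pow_mul, sq]
  have hσ3 : ∀ x, σ (σ (σ x)) = x := by
    intro x
    rw [hσ, ← e2, ← pow_mul, ← pow_succ, ← hL, FiniteField.pow_card]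
  have e1 : ∀ y : L, y ^ q = σ y := fun y => (hσ y).symm
  have m1 : ∀ (y : L) (k : ℕ), y ^ (k * q) = σ y ^ k := by
    intro y k; rw [mul_comm, pow_mul, e1]
  have m2 : ∀ (y : L) (k : ℕ), y ^ (k * q ^ 2) = σ (σ y) ^ k := by
    intro y k; rw [mul_comm, pow_mul, e2]
  simp only [m1, m2, e1, e2] at hf ⊢
  refine forall_congr' fun ε => forall_congr' fun _ => ?_
  have hsplit : (fun x : L => f (x + ε) - f x) = (Equiv.addRight (f ε)) ∘
      (fun x => (2 * algebraMap K L E * ε + algebraMap K L A * σ ε + algebraMap K L B * σ (σ ε)) * x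
        + (algebraMap K L A * ε + 2 * algebraMap K L C * σ ε) * σ x
        + (algebraMap K L B * ε + 2 * algebraMap K L D * σ (σ ε)) * σ (σ x)) := by
    funext x
    simp only [hf, Function.comp, map_add, Equiv.coe_addRight]
    ring
  rw [hsplit, Function.Bijective.of_comp_iff' (Equiv.addRight (f ε)).bijective,
    aux_dickson q hq L hL σ hσ hσ3]
  refine not_congr (Eq.congr_left ?_)
  rw [Matrix.det_fin_three]
  have t2 : σ 2 = 2 := map_ofNat σ 2
  have t2L : ∀ (n : ℕ) [n.AtLeastTwo], algebraMap K L (OfNat.ofNat n) = OfNat.ofNat n := fun n _ => map_ofNat _ n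
  simp [hσ3, hσK, t2, t2L]
  ring
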